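/- Let q ∈ [2,∞), p ∈ [1,∞) and K > 0. There is a constant C = C(p,q,K) such that for every real Banach space X having cotype q with constant K, every n ∈ ℕ, and every F : {-1,1}^n × {-1,1}^n → X, setting F_j(ε) := E_δ[δ_j F(ε,δ)] for j = 1,…,n, one has (E_ε‖Σ_{j=1}^n Δ^{-1} D_j F_j‖_X^p)^{1/p} ≤ C · √n · (E_{δ,ε}‖F(ε,δ)‖_X^p)^{1/p}. -/

import Mathlib

open scoped BigOperators
open Finset

noncomputable section

/-- The ±1 value of a Boolean coordinate. -/
def rad (b : Bool) : ℝ := if b then 1 else -1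

/-- Expectation over the uniform measure on the discrete cube `{-1,1}^n`
(points encoded as `Fin n → Bool`). -/
def cubeAvg {n : ℕ} {X : Type*} [AddCommGroup X] [Module ℝ X]
    (f : (Fin n → Bool) → X) : X :=
  ((2 ^ n : ℝ)⁻¹) • ∑ ε : Fin n → Bool, f ε

/-- Walsh character `w_A(ε) = ∏_{i ∈ A} ε_i`. -/
def walshChar {n : ℕ} (A : Finset (Fin n)) (ε : Fin n → Bool) : ℝ :=
  ∏ i ∈ A, rad (ε i)

/-- Walsh coefficient `f̂(A) = E_ε [f(ε) w_A(ε)]`. -/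
def wcoef {n : ℕ} {X : Type*} [AddCommGroup X] [Module ℝ X]
    (f : (Fin n → Bool) → X) (A : Finset (Fin n)) : X :=
  cubeAvg (fun ε => walshChar A ε • f ε)

/-- Flip the `j`-th coordinate. -/
def flipCoord {n : ℕ} (j : Fin n) (ε : Fin n → Bool) : Fin n → Bool :=
  Function.update ε j (!(ε j))

/-- Discrete derivative `D_j f(ε) = (f(ε) - f(σ_j ε))/2`. -/
def Dop {n : ℕ} {X : Type*} [AddCommGroup X] [Module ℝ X]
    (j : Fin n) (f : (Fin n → Bool) → X) : (Fin n → Bool) → X :=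
  fun ε => (2 : ℝ)⁻¹ • (f ε - f (flipCoord j ε))

/-- Heat semigroup `P_t f = Σ_A e^{-t|A|} f̂(A) w_A`. -/
def heatOp {n : ℕ} {X : Type*} [AddCommGroup X] [Module ℝ X]
    (t : ℝ) (f : (Fin n → Bool) → X) : (Fin n → Bool) → X :=
  fun ε => ∑ A : Finset (Fin n), (Real.exp (-t * A.card) * walshChar A ε) • wcoef f A

/-- Fractional power of the Laplacian on mean-zero parts:
`Δ^a f = Σ_{A ≠ ∅} |A|^a f̂(A) w_A`. -/
def lapPow {n : ℕ} {X : Type*} [AddCommGroup X] [Module ℝ X]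
    (a : ℝ) (f : (Fin n → Bool) → X) : (Fin n → Bool) → X :=
  fun ε => ∑ A ∈ Finset.univ.filter (fun A : Finset (Fin n) => A ≠ ∅),
    (((A.card : ℝ)) ^ a * walshChar A ε) • wcoef f A

/-- `X` has cotype `q` with constant `K`. -/
def HasCotypeConst (X : Type*) [NormedAddCommGroup X] [NormedSpace ℝ X] (q K : ℝ) : Prop :=
  ∀ m : ℕ, ∀ x : Fin m → X,
    (∑ j, ‖x j‖ ^ q) ^ (1 / q) ≤
      K * (cubeAvg (fun δ : Fin m → Bool => ‖∑ j, rad (δ j) • x j‖ ^ (2 : ℝ))) ^ (1 / 2 : ℝ)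

/-- `X` has type `s` with constant `T`. -/
def HasTypeConst (X : Type*) [NormedAddCommGroup X] [NormedSpace ℝ X] (s T : ℝ) : Prop :=
  ∀ m : ℕ, ∀ x : Fin m → X,
    (cubeAvg (fun δ : Fin m → Bool => ‖∑ j, rad (δ j) • x j‖ ^ (2 : ℝ))) ^ (1 / 2 : ℝ) ≤
      T * (∑ j, ‖x j‖ ^ s) ^ (1 / s)


lemma rad_sq (b : Bool) : rad b * rad b = 1 := by cases b <;> simp [rad]

lemma abs_rad (b : Bool) : |rad b| = 1 := by cases b <;> simp [rad]

lemma rad_beq (a b : Bool) : rad (a == b) = rad a * rad b := by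
  cases a <;> cases b <;> simp [rad]

lemma walsh_sum {n : ℕ} (j : Fin n) (s : ℝ) (ξ : Fin n → Bool) :
    ∑ A ∈ univ.filter (fun A : Finset (Fin n) => j ∈ A), s ^ (A.card - 1) * walshChar A ξ
      = rad (ξ j) * ∏ i ∈ univ.erase j, (1 + s * rad (ξ i)) := by
  rw [Finset.prod_one_add, Finset.mul_sum]
  refine Finset.sum_nbij' (fun A => A.erase j) (fun B => insert j B) ?_ ?_ ?_ ?_ ?_
  · intro A _
    simp only [mem_powerset]
    exact Finset.erase_subset_erase _ (subset_univ _)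
  · intro B _
    simp
  · intro A hA
    simp only [mem_filter] at hA
    exact Finset.insert_erase hA.2
  · intro B hB
    simp only [mem_powerset] at hB
    apply Finset.erase_insert
    intro h
    exact Finset.notMem_erase _ _ (hB h)
  · intro A hA
    simp only [mem_filter] at hA
    rw [Finset.prod_mul_distrib, Finset.prod_const, Finset.card_erase_of_mem hA.2, walshChar,
      ← Finset.mul_prod_erase A _ hA.2]
    ring

lemma sum_prod_bool {n : ℕ} (g : Fin n → Bool → ℝ) :
    ∑ ξ : Fin n → Bool, ∏ i, g i (ξ i) = ∏ i, (g i true + g i false) := by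
  have := Finset.prod_univ_sum (fun _ : Fin n => (univ : Finset Bool)) g
  simp only [Fintype.piFinset_univ, Fintype.sum_bool] at this
  exact this.symm

lemma second_moment {n : ℕ} (δ : Fin n → Bool) (s : ℝ) (h0 : 0 ≤ s) (h1 : s < 1) :
    ∑ ξ : Fin n → Bool, (∏ i, (1 + s * rad (ξ i))) *
      (∑ j, rad (δ j) * (rad (ξ j) / (1 + s * rad (ξ j)))) ^ 2 = 2 ^ n * n / (1 - s ^ 2) := by
  have hp : ∀ b, 0 < 1 + s * rad b := by
    intro b; cases b <;> simp [rad] <;> linarith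
  have key : ∀ j k : Fin n, ∑ ξ : Fin n → Bool, (∏ i, (1 + s * rad (ξ i))) *
      ((rad (ξ j) / (1 + s * rad (ξ j))) * (rad (ξ k) / (1 + s * rad (ξ k)))) =
      if j = k then 2 ^ n / (1 - s ^ 2) else 0 := by
    intro j k
    have e : ∀ ξ : Fin n → Bool, (∏ i, (1 + s * rad (ξ i))) *
      ((rad (ξ j) / (1 + s * rad (ξ j))) * (rad (ξ k) / (1 + s * rad (ξ k)))) =
      ∏ i, (fun (i : Fin n) (b : Bool) => (1 + s * rad b) *
        ((if i = j then (rad b / (1 + s * rad b)) else 1) *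
         (if i = k then (rad b / (1 + s * rad b)) else 1))) i (ξ i) := by
      intro ξ
      simp only [Finset.prod_mul_distrib]
      simp
    rw [Finset.sum_congr rfl (fun ξ _ => e ξ)]
    refine (sum_prod_bool (fun (i : Fin n) (b : Bool) => (1 + s * rad b) *
        ((if i = j then (rad b / (1 + s * rad b)) else 1) *
         (if i = k then (rad b / (1 + s * rad b)) else 1)))).trans ?_
    split_ifs with h
    · subst h
      rw [← Finset.mul_prod_erase univ _ (mem_univ j)]
      have : ∀ i ∈ univ.erase j, ((fun (i : Fin n) (b : Bool) => (1 + s * rad b) *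
        ((if i = j then (rad b / (1 + s * rad b)) else 1) *
         (if i = j then (rad b / (1 + s * rad b)) else 1))) i true + (fun (i : Fin n) (b : Bool) => (1 + s * rad b) *
        ((if i = j then (rad b / (1 + s * rad b)) else 1) *
         (if i = j then (rad b / (1 + s * rad b)) else 1))) i false) = 2 := by
        intro i hi
        have : i ≠ j := Finset.ne_of_mem_erase hi
        simp [this, rad]; ring
      rw [Finset.prod_congr rfl this, Finset.prod_const, Finset.card_erase_of_mem (mem_univ j)]
      have hn : n = (n - 1) + 1 := by have := j.2; omega
      have hc : (univ : Finset (Fin n)).card - 1 = n - 1 := by simp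
      rw [hc]
      conv_rhs => rw [hn, pow_succ]
      have a1 : 1 + s ≠ 0 := by linarith
      have a2 : 1 - s ≠ 0 := by linarith
      have a2' : 1 + -s ≠ 0 := by intro h; apply a2; linarith
      have a3 : 1 - s ^ 2 ≠ 0 := by
        have : 1 - s ^ 2 = (1 + s) * (1 - s) := by ring
        rw [this]; exact mul_ne_zero a1 a2
      simp [rad]
      field_simp
      ring
    · apply Finset.prod_eq_zero (mem_univ j)
      simp only [h, if_true, if_false, mul_one]
      have t := (hp true).ne'
      have f := (hp false).ne'
      rw [mul_div_cancel₀ _ t, mul_div_cancel₀ _ f]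
      simp [rad]
  have e2 : ∀ ξ : Fin n → Bool, (∏ i, (1 + s * rad (ξ i))) *
      (∑ j, rad (δ j) * (rad (ξ j) / (1 + s * rad (ξ j)))) ^ 2 =
      ∑ j, ∑ k, rad (δ j) * rad (δ k) * ((∏ i, (1 + s * rad (ξ i))) *
      ((rad (ξ j) / (1 + s * rad (ξ j))) * (rad (ξ k) / (1 + s * rad (ξ k))))) := by
    intro ξ
    rw [sq, Finset.sum_mul_sum, Finset.mul_sum]
    refine Finset.sum_congr rfl fun j _ => ?_
    rw [Finset.mul_sum]
    refine Finset.sum_congr rfl fun k _ => ?_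
    ring
  rw [Finset.sum_congr rfl (fun ξ _ => e2 ξ), Finset.sum_comm]
  have e3 : ∀ j : Fin n, ∑ ξ : Fin n → Bool, ∑ k, rad (δ j) * rad (δ k) *
     ((∏ i, (1 + s * rad (ξ i))) *
      ((rad (ξ j) / (1 + s * rad (ξ j))) * (rad (ξ k) / (1 + s * rad (ξ k))))) =
      2 ^ n / (1 - s ^ 2) := by
    intro j
    rw [Finset.sum_comm]
    simp only [← Finset.mul_sum, key]
    simp [rad_sq]
  rw [Finset.sum_congr rfl (fun j _ => e3 j)]
  simp
  ring

lemma T_bound {n : ℕ} (δ : Fin n → Bool) (s : ℝ) (h0 : 0 ≤ s) (h1 : s < 1) :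
    ∑ ξ : Fin n → Bool, |∑ j, rad (δ j) *
      (rad (ξ j) * ∏ i ∈ univ.erase j, (1 + s * rad (ξ i)))| ≤
      2 ^ n * (Real.sqrt n / Real.sqrt (1 - s ^ 2)) := by
  have hp : ∀ b, 0 < 1 + s * rad b := by
    intro b; cases b <;> simp [rad] <;> linarith
  have hs : 0 < 1 - s ^ 2 := by nlinarith
  set ρ : (Fin n → Bool) → ℝ := fun ξ => ∏ i, (1 + s * rad (ξ i)) with hρ
  set S : (Fin n → Bool) → ℝ :=
    fun ξ => ∑ j, rad (δ j) * (rad (ξ j) / (1 + s * rad (ξ j))) with hS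
  have hρ0 : ∀ ξ, 0 < ρ ξ := fun ξ => Finset.prod_pos fun i _ => hp _
  have e : ∀ ξ : Fin n → Bool, |∑ j, rad (δ j) *
      (rad (ξ j) * ∏ i ∈ univ.erase j, (1 + s * rad (ξ i)))| = ρ ξ * |S ξ| := by
    intro ξ
    rw [← abs_of_pos (hρ0 ξ), ← abs_mul, hS]
    simp only [Finset.mul_sum]
    congr 1
    refine Finset.sum_congr rfl fun j _ => ?_
    simp only [hρ]
    rw [← Finset.mul_prod_erase univ _ (mem_univ j)]
    have := (hp (ξ j)).ne'
    generalize 1 + s * rad (ξ j) = a at this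
    field_simp
  rw [Finset.sum_congr rfl (fun ξ _ => e ξ)]
  have m1 : ∑ ξ, ρ ξ = 2 ^ n := by
    have := sum_prod_bool (n := n) (fun _ b => 1 + s * rad b)
    simp only [hρ, this]
    have : (1 + s * rad true + (1 + s * rad false)) = 2 := by simp [rad]; ring
    simp [this]
  have m2 : ∑ ξ, ρ ξ * S ξ ^ 2 = 2 ^ n * n / (1 - s ^ 2) := second_moment δ s h0 h1
  have cs := Finset.sum_sq_le_sum_mul_sum_of_sq_le_mul (univ : Finset (Fin n → Bool))
    (r := fun ξ => ρ ξ * |S ξ|) (f := ρ) (g := fun ξ => ρ ξ * S ξ ^ 2)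
    (fun ξ _ => (hρ0 ξ).le) (fun ξ _ => mul_nonneg (hρ0 ξ).le (sq_nonneg _))
    (fun ξ _ => by rw [mul_pow, sq_abs]; exact le_of_eq (by ring))
  rw [m1, m2] at cs
  apply le_of_sq_le_sq _ (by positivity)
  refine cs.trans (le_of_eq ?_)
  rw [mul_pow, div_pow, Real.sq_sqrt (Nat.cast_nonneg n), Real.sq_sqrt hs.le]
  ring

/-- the kernel -/
def kern {n : ℕ} (δ ξ : Fin n → Bool) : ℝ :=
  ∑ j, ∑ A ∈ univ.filter (fun A : Finset (Fin n) => j ∈ A),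
    rad (δ j) * ((A.card : ℝ)⁻¹ * walshChar A ξ)

lemma kern_bound {n : ℕ} (δ : Fin n → Bool) :
    ∑ ξ : Fin n → Bool, |kern δ ξ| ≤ 2 ^ n * (Real.pi / 2 * Real.sqrt n) := by
  set σ : (Fin n → Bool) → ℝ := fun ξ => SignType.sign (kern δ ξ) with hσ
  have hσ1 : ∀ ξ, |σ ξ| ≤ 1 := by
    intro ξ
    simp only [hσ]
    rcases lt_trichotomy (kern δ ξ) 0 with h | h | h <;> simp [h]
  set φ : ℝ → ℝ := fun θ => ∑ ξ, σ ξ * ∑ j, ∑ A ∈ univ.filter (fun A : Finset (Fin n) => j ∈ A),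
    rad (δ j) * ((A.card : ℝ)⁻¹ * walshChar A ξ) * Real.sin θ ^ A.card with hφ
  have hd : ∀ θ, HasDerivAt φ (∑ ξ, σ ξ * (Real.cos θ * ∑ j, rad (δ j) *
      (rad (ξ j) * ∏ i ∈ univ.erase j, (1 + Real.sin θ * rad (ξ i))))) θ := by
    intro θ
    refine HasDerivAt.fun_sum fun ξ _ => HasDerivAt.const_mul _ ?_
    rw [Finset.mul_sum]
    refine HasDerivAt.fun_sum fun j _ => ?_
    rw [← walsh_sum, Finset.mul_sum, Finset.mul_sum]
    refine HasDerivAt.fun_sum fun A hA => ?_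
    have hc : (A.card : ℝ) ≠ 0 := by
      simp only [mem_filter] at hA
      exact_mod_cast (Finset.card_pos.mpr ⟨j, hA.2⟩).ne'
    have := ((Real.hasDerivAt_sin θ).fun_pow A.card).const_mul
      (rad (δ j) * ((A.card : ℝ)⁻¹ * walshChar A ξ))
    refine this.congr_deriv ?_
    field_simp
  have hle := Convex.image_sub_le_mul_sub_of_deriv_le (convex_Icc (0:ℝ) (Real.pi / 2))
    (f := φ) (C := 2 ^ n * Real.sqrt n) (fun θ _ => (hd θ).continuousAt.continuousWithinAt)
    (fun θ _ => (hd θ).differentiableAt.differentiableWithinAt) (by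
      intro θ hθ
      rw [interior_Icc] at hθ
      rw [(hd θ).deriv]
      have hcos : 0 < Real.cos θ := Real.cos_pos_of_mem_Ioo ⟨by linarith [hθ.1, Real.pi_pos], hθ.2⟩
      have hsin : 0 ≤ Real.sin θ :=
        Real.sin_nonneg_of_nonneg_of_le_pi hθ.1.le (by linarith [hθ.2, Real.pi_pos])
      have hcs := Real.sin_sq_add_cos_sq θ
      have hsin1 : Real.sin θ < 1 := by nlinarith
      have hb := T_bound δ (Real.sin θ) hsin hsin1
      have hq : Real.sqrt (1 - Real.sin θ ^ 2) = Real.cos θ := by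
        rw [show 1 - Real.sin θ ^ 2 = Real.cos θ ^ 2 by linarith, Real.sqrt_sq hcos.le]
      rw [hq] at hb
      calc _ ≤ ∑ ξ : Fin n → Bool, Real.cos θ * |∑ j, rad (δ j) *
              (rad (ξ j) * ∏ i ∈ univ.erase j, (1 + Real.sin θ * rad (ξ i)))| := by
            refine Finset.sum_le_sum fun ξ _ => (le_abs_self _).trans ?_
            rw [abs_mul, abs_mul, abs_of_pos hcos]
            exact mul_le_of_le_one_left (by positivity) (hσ1 ξ)
        _ ≤ Real.cos θ * (2 ^ n * (Real.sqrt n / Real.cos θ)) := by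
            rw [← Finset.mul_sum]
            exact mul_le_mul_of_nonneg_left hb hcos.le
        _ = _ := by field_simp)
    0 ⟨le_rfl, by positivity⟩ (Real.pi / 2) ⟨by positivity, le_rfl⟩ (by positivity)
  have hφ0 : φ 0 = 0 := by
    simp only [hφ]
    refine Finset.sum_eq_zero fun ξ _ => ?_
    rw [Finset.sum_eq_zero, mul_zero]
    refine fun j _ => Finset.sum_eq_zero fun A hA => ?_
    simp only [mem_filter] at hA
    rw [Real.sin_zero, zero_pow (Finset.card_pos.mpr ⟨j, hA.2⟩).ne', mul_zero]
  have hφ1 : φ (Real.pi / 2) = ∑ ξ, |kern δ ξ| := by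
    simp only [hφ, Real.sin_pi_div_two, one_pow, mul_one]
    refine Finset.sum_congr rfl fun ξ _ => ?_
    exact sign_mul_self (kern δ ξ)
  rw [hφ0, hφ1] at hle
  linarith

/-- product of cube points -/
def cmul {n : ℕ} (ε η : Fin n → Bool) : Fin n → Bool := fun i => ε i == η i

lemma walsh_cmul {n : ℕ} (A : Finset (Fin n)) (ε η : Fin n → Bool) :
    walshChar A (cmul ε η) = walshChar A ε * walshChar A η := by
  simp [walshChar, cmul, rad_beq, Finset.prod_mul_distrib]

lemma cmul_comm {n : ℕ} (ε η : Fin n → Bool) : cmul ε η = cmul η ε := by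
  funext i; simp only [cmul]; cases ε i <;> cases η i <;> rfl

lemma sum_cmul {n : ℕ} (ε : Fin n → Bool) (f : (Fin n → Bool) → ℝ) :
    ∑ η, f (cmul ε η) = ∑ η, f η := by
  have h : ∀ η, cmul ε (cmul ε η) = η := by
    intro η; funext i; simp only [cmul]; cases ε i <;> cases η i <;> rfl
  exact Finset.sum_nbij' (cmul ε) (cmul ε) (by simp) (by simp) (fun η _ => h η) (fun η _ => h η)
    (fun _ _ => rfl)

lemma flipCoord_flipCoord {n : ℕ} (j : Fin n) (ε : Fin n → Bool) : flipCoord j (flipCoord j ε) = ε := by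
  simp [flipCoord]

lemma walsh_flip {n : ℕ} (j : Fin n) (A : Finset (Fin n)) (ε : Fin n → Bool) :
    walshChar A (flipCoord j ε) = if j ∈ A then - walshChar A ε else walshChar A ε := by
  split_ifs with h
  · rw [walshChar, walshChar, ← Finset.mul_prod_erase A _ h, ← Finset.mul_prod_erase A _ h,
      ← neg_mul]
    congr 1
    · simp only [flipCoord, Function.update_self]; cases ε j <;> simp [rad]
    · refine Finset.prod_congr rfl fun i hi => ?_
      simp [flipCoord, Function.update_of_ne (Finset.ne_of_mem_erase hi)]
  · refine Finset.prod_congr rfl fun i hi => ?_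
    have : i ≠ j := by rintro rfl; exact h hi
    simp [flipCoord, Function.update_of_ne this]

lemma wcoef_Dop {n : ℕ} {X : Type*} [AddCommGroup X] [Module ℝ X]
    (j : Fin n) (f : (Fin n → Bool) → X) (A : Finset (Fin n)) :
    wcoef (Dop j f) A = if j ∈ A then wcoef f A else 0 := by
  have h : ∑ ε, walshChar A ε • f (flipCoord j ε) = ∑ ε, walshChar A (flipCoord j ε) • f ε :=
    Finset.sum_nbij' (flipCoord j) (flipCoord j) (by simp) (by simp)
      (fun η _ => flipCoord_flipCoord j η) (fun η _ => flipCoord_flipCoord j η) (fun η _ => by rw [flipCoord_flipCoord])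
  have h2 : ∑ ε, walshChar A ε • Dop j f ε =
      (2:ℝ)⁻¹ • (∑ ε, walshChar A ε • f ε - ∑ ε, walshChar A (flipCoord j ε) • f ε) := by
    rw [← h, ← Finset.sum_sub_distrib, Finset.smul_sum]
    refine Finset.sum_congr rfl fun ε _ => ?_
    rw [Dop, smul_comm, smul_sub]
  simp only [wcoef, cubeAvg]
  rw [h2]
  split_ifs with hj
  · simp only [walsh_flip, hj, if_true, neg_smul, Finset.sum_neg_distrib, sub_neg_eq_add]
    rw [← two_smul ℝ, inv_smul_smul₀ two_ne_zero]
  · simp only [walsh_flip, hj, if_false, sub_self, smul_zero]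

lemma repr_kern {n : ℕ} {X : Type*} [AddCommGroup X] [Module ℝ X]
    (F : (Fin n → Bool) → (Fin n → Bool) → X) (ε : Fin n → Bool) :
    ∑ j, lapPow (-1)
      (Dop j (fun ε' => cubeAvg (fun δ : Fin n → Bool => rad (δ j) • F ε' δ))) ε =
    ∑ z : (Fin n → Bool) × (Fin n → Bool),
      ((2 ^ n : ℝ)⁻¹ * (2 ^ n : ℝ)⁻¹ * kern z.2 (cmul ε z.1)) • F z.1 z.2 := by
  have e1 : ∀ j : Fin n, lapPow (-1)
      (Dop j (fun ε' => cubeAvg (fun δ : Fin n → Bool => rad (δ j) • F ε' δ))) ε =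
      ∑ A ∈ univ.filter (fun A : Finset (Fin n) => j ∈ A), ∑ η : Fin n → Bool,
        ∑ δ : Fin n → Bool, ((2 ^ n : ℝ)⁻¹ * (2 ^ n : ℝ)⁻¹ *
          (rad (δ j) * ((A.card : ℝ)⁻¹ * walshChar A (cmul ε η)))) • F η δ := by
    intro j
    simp only [lapPow, wcoef_Dop]
    symm
    refine Finset.sum_subset_zero_on_sdiff ?_ ?_ ?_
    · intro A hA
      simp only [mem_filter, mem_univ, true_and] at hA ⊢
      exact Finset.ne_empty_of_mem hA
    · intro A hA
      simp only [mem_sdiff, mem_filter, mem_univ, true_and] at hA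
      simp [hA.2]
    · intro A hA
      simp only [mem_filter, mem_univ, true_and] at hA
      simp only [hA, if_true, wcoef, cubeAvg, Finset.smul_sum, smul_smul, walsh_cmul,
        Real.rpow_neg_one]
      refine Finset.sum_congr rfl fun η _ => Finset.sum_congr rfl fun δ _ => ?_
      congr 1
      ring
  simp only [e1, kern, Fintype.sum_prod_type, Finset.mul_sum, Finset.sum_smul]
  have : ∀ j : Fin n, ∑ A ∈ univ.filter (fun A : Finset (Fin n) => j ∈ A), ∑ η : Fin n → Bool,
        ∑ δ : Fin n → Bool, ((2 ^ n : ℝ)⁻¹ * (2 ^ n : ℝ)⁻¹ *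
          (rad (δ j) * ((A.card : ℝ)⁻¹ * walshChar A (cmul ε η)))) • F η δ =
      ∑ η : Fin n → Bool, ∑ δ : Fin n → Bool,
        ∑ A ∈ univ.filter (fun A : Finset (Fin n) => j ∈ A), ((2 ^ n : ℝ)⁻¹ * (2 ^ n : ℝ)⁻¹ *
          (rad (δ j) * ((A.card : ℝ)⁻¹ * walshChar A (cmul ε η)))) • F η δ := by
    intro j
    rw [Finset.sum_comm]
    exact Finset.sum_congr rfl fun η _ => Finset.sum_comm
  rw [Finset.sum_congr rfl fun j _ => this j, Finset.sum_comm]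
  exact Finset.sum_congr rfl fun η _ => Finset.sum_comm

lemma schur {α β : Type*} [Fintype α] [Fintype β] {X : Type*} [NormedAddCommGroup X]
    [NormedSpace ℝ X] (a : α → β → ℝ) (F : β → X) (p B B' : ℝ) (hp : 1 ≤ p) (hB : 0 ≤ B)
    (h1 : ∀ x, ∑ y, |a x y| ≤ B) (h2 : ∀ y, ∑ x, |a x y| ≤ B') :
    ∑ x, ‖∑ y, a x y • F y‖ ^ p ≤ B ^ (p - 1) * B' * ∑ y, ‖F y‖ ^ p := by
  have hp0 : 0 < p := by linarith
  have hx : ∀ x, ‖∑ y, a x y • F y‖ ^ p ≤ B ^ (p - 1) * ∑ y, |a x y| * ‖F y‖ ^ p := by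
    intro x
    have n1 : ‖∑ y, a x y • F y‖ ≤ ∑ y, |a x y| * ‖F y‖ := by
      refine (norm_sum_le _ _).trans (le_of_eq ?_)
      simp [norm_smul]
    have n2 := Real.inner_le_weight_mul_Lp_of_nonneg univ hp (fun y => |a x y|)
      (fun y => ‖F y‖) (fun y => abs_nonneg _) (fun y => norm_nonneg _)
    have s0 : 0 ≤ ∑ y, |a x y| := Finset.sum_nonneg fun _ _ => abs_nonneg _
    have s1 : 0 ≤ ∑ y, |a x y| * ‖F y‖ ^ p := Finset.sum_nonneg fun _ _ => by positivity
    calc _ ≤ ((∑ y, |a x y|) ^ (1 - p⁻¹) * (∑ y, |a x y| * ‖F y‖ ^ p) ^ p⁻¹) ^ p :=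
          Real.rpow_le_rpow (norm_nonneg _) (n1.trans n2) hp0.le
      _ = (∑ y, |a x y|) ^ (p - 1) * ∑ y, |a x y| * ‖F y‖ ^ p := by
          rw [Real.mul_rpow (by positivity) (by positivity), ← Real.rpow_mul s0,
            ← Real.rpow_mul s1, inv_mul_cancel₀ hp0.ne', Real.rpow_one]
          congr 2
          field_simp
      _ ≤ _ := mul_le_mul_of_nonneg_right
          (Real.rpow_le_rpow s0 (h1 x) (by linarith)) s1
  refine (Finset.sum_le_sum fun x _ => hx x).trans ?_
  rw [← Finset.mul_sum, Finset.sum_comm, mul_assoc]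
  refine mul_le_mul_of_nonneg_left ?_ (Real.rpow_nonneg hB _)
  rw [Finset.mul_sum]
  refine Finset.sum_le_sum fun y _ => ?_
  rw [← Finset.sum_mul]
  exact mul_le_mul_of_nonneg_right (h2 y) (by positivity)

/-- generalized Pisier inequality with constant `C(p,q,K)·√n` for
cotype-`q` spaces. -/
theorem general_pisier_sqrt_n.{u} (q p K : ℝ) (hq : 2 ≤ q) (hp : 1 ≤ p) (hK : 0 < K) :
    ∃ C : ℝ, ∀ (X : Type u) [NormedAddCommGroup X] [NormedSpace ℝ X] [CompleteSpace X],
      HasCotypeConst X q K →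
      ∀ (n : ℕ) (F : (Fin n → Bool) → (Fin n → Bool) → X),
        (cubeAvg (fun ε =>
            ‖∑ j, lapPow (-1)
              (Dop j (fun ε' => cubeAvg (fun δ : Fin n → Bool => rad (δ j) • F ε' δ))) ε‖
            ^ p)) ^ (1 / p) ≤
          C * Real.sqrt n * (cubeAvg (fun δ : Fin n → Bool => cubeAvg (fun ε =>
            ‖F ε δ‖ ^ p))) ^ (1 / p) := by
  refine ⟨Real.pi / 2, ?_⟩
  intro X _ _ _ _ n F
  have hp0 : 0 < p := by linarith
  set B : ℝ := Real.pi / 2 * Real.sqrt n with hB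
  have hB0 : 0 ≤ B := by positivity
  have hN : (0:ℝ) < 2 ^ n := by positivity
  have hN1 : (2 ^ n : ℝ)⁻¹ * 2 ^ n = 1 := inv_mul_cancel₀ hN.ne'
  have habs : ∀ x : ℝ, |(2 ^ n : ℝ)⁻¹ * (2 ^ n : ℝ)⁻¹ * x| =
      (2 ^ n : ℝ)⁻¹ * (2 ^ n : ℝ)⁻¹ * |x| := by
    intro x
    rw [abs_mul, abs_of_nonneg (by positivity)]
  have main := schur (X := X) (α := Fin n → Bool) (β := (Fin n → Bool) × (Fin n → Bool))
    (fun ε z => (2 ^ n : ℝ)⁻¹ * (2 ^ n : ℝ)⁻¹ * kern z.2 (cmul ε z.1))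
    (fun z => F z.1 z.2) p B ((2 ^ n : ℝ)⁻¹ * B) hp hB0
    (by
      intro ε
      simp only [habs]
      rw [← Finset.mul_sum, Fintype.sum_prod_type, Finset.sum_comm]
      have : ∀ δ : Fin n → Bool, ∑ η, |kern δ (cmul ε η)| ≤ 2 ^ n * B := fun δ => by
        rw [sum_cmul ε (fun ξ => |kern δ ξ|)]
        exact kern_bound δ
      calc _ ≤ (2 ^ n : ℝ)⁻¹ * (2 ^ n : ℝ)⁻¹ * ∑ δ : Fin n → Bool, 2 ^ n * B := by
            refine mul_le_mul_of_nonneg_left (Finset.sum_le_sum fun δ _ => this δ) (by positivity)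
        _ = B := by
            simp
            field_simp)
    (by
      intro z
      simp only [habs]
      rw [← Finset.mul_sum]
      have : ∑ ε, |kern z.2 (cmul ε z.1)| ≤ 2 ^ n * B := by
        simp only [cmul_comm _ z.1]
        rw [sum_cmul z.1 (fun ξ => |kern z.2 ξ|)]
        exact kern_bound z.2
      calc _ ≤ (2 ^ n : ℝ)⁻¹ * (2 ^ n : ℝ)⁻¹ * (2 ^ n * B) :=
            mul_le_mul_of_nonneg_left this (by positivity)
        _ = _ := by field_simp)
  simp only [repr_kern]
  have hBp : B ^ (p - 1) * B = B ^ p := by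
    rcases hB0.eq_or_lt with h | h
    · rw [← h, mul_zero, Real.zero_rpow hp0.ne']
    · rw [← Real.rpow_add_one h.ne', sub_add_cancel]
  set R : ℝ := cubeAvg (fun δ : Fin n → Bool => cubeAvg (fun ε => ‖F ε δ‖ ^ p)) with hR
  have hR0 : 0 ≤ R := by
    simp only [hR, cubeAvg, smul_eq_mul]
    positivity
  have hRe : R = (2 ^ n : ℝ)⁻¹ * ((2 ^ n : ℝ)⁻¹ *
      ∑ z : (Fin n → Bool) × (Fin n → Bool), ‖F z.1 z.2‖ ^ p) := by
    rw [Fintype.sum_prod_type, Finset.sum_comm]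
    simp only [hR, cubeAvg, smul_eq_mul, Finset.mul_sum]
  have step : cubeAvg (fun ε : Fin n → Bool =>
      ‖∑ z : (Fin n → Bool) × (Fin n → Bool),
        ((2 ^ n : ℝ)⁻¹ * (2 ^ n : ℝ)⁻¹ * kern z.2 (cmul ε z.1)) • F z.1 z.2‖ ^ p) ≤ B ^ p * R := by
    rw [cubeAvg, smul_eq_mul]
    refine (mul_le_mul_of_nonneg_left main (by positivity)).trans (le_of_eq ?_)
    rw [hRe, ← hBp]
    ring
  calc _ ≤ (B ^ p * R) ^ (1 / p) := by
        refine Real.rpow_le_rpow ?_ step (by positivity)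
        simp only [cubeAvg, smul_eq_mul]
        positivity
    _ = _ := by
        rw [Real.mul_rpow (by positivity) hR0, ← Real.rpow_mul hB0, mul_one_div_cancel hp0.ne',
          Real.rpow_one]

end
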